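/- arXiv:2201.10124 — 3 statements merged into one kernel-verified Lean document; each statement's English description precedes it below -/
import Mathlib

section
/- Let z ∈ ℂ with Im z > 0, set τ := −iz and q := e(z) = e^{−2πτ}, and let (α,β) ∈ ℝ²∖ℤ² with w := α + βz. Then ℘(w | 1,z) = −(π²/3)·E₂(z) + δ(β)·π²/sin²(πα) − 4π²·( 𝒮_{−1}(β,0;0,α;q) + 𝒮_{−1}(−β,0;0,−α;q) ), where δ(β) = 1 if β ∈ ℤ and 0 otherwise (and when β ∈ ℤ one has α ∉ ℤ, so sin(πα) ≠ 0). -/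
noncomputable section

open Complex MeasureTheory
open scoped Real Classical

/-- `e(s) = exp(2 π i s)`. -/
def ee (s : ℂ) : ℂ := Complex.exp (2 * (Real.pi : ℂ) * Complex.I * s)

/-- `δ(x) = 1` if `x ∈ ℤ`, `0` otherwise. -/
def dInt (x : ℝ) : ℂ := if ∃ n : ℤ, (n : ℝ) = x then 1 else 0

/-- The Lerch zeta function `ψ(r,γ,κ) = Σ_{k ∈ ℤ, γ+k>0} e((γ+k)κ) (γ+k)^{-r}`
(a convergent series when `Re r > 1`). -/
def psiL (r : ℂ) (γ κ : ℝ) : ℂ :=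
  ∑' k : {k : ℤ // 0 < γ + (k : ℝ)},
    ee ((((γ + (k.1 : ℝ)) * κ : ℝ)) : ℂ) * (((γ + (k.1 : ℝ)) : ℝ) : ℂ) ^ (-r)

/-- The `q`-series `𝒮_r(γ,δ;κ,λ;q)`, where `q = e^{-2πt}` with `Re t > 0`, and the power
`q^{(γ+k)(δ+l)}` is interpreted as `exp (-2πt(γ+k)(δ+l))`. -/
def Scal (r : ℂ) (γ δ' κ lam : ℝ) (t : ℂ) : ℂ :=
  ∑' (k : {k : ℤ // 0 < γ + (k : ℝ)}) (l : {l : ℤ // 0 < δ' + (l : ℝ)}),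
    ee ((((γ + (k.1 : ℝ)) * κ + (δ' + (l.1 : ℝ)) * lam : ℝ)) : ℂ) *
      (((δ' + (l.1 : ℝ)) : ℝ) : ℂ) ^ (-r) *
      Complex.exp (-2 * (Real.pi : ℂ) * t * ((γ + (k.1 : ℝ) : ℝ) : ℂ) * ((δ' + (l.1 : ℝ) : ℝ) : ℂ))

/-- The generalized Eisenstein series `F_{ℤ²}(s;α,β;μ,ν;z)` (mean of the two branch
conventions), defined by an absolutely convergent series for `Re s > 2`. -/
def Fz2 (s : ℂ) (α β μ ν : ℝ) (z : ℂ) : ℂ :=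
  (∑' p : {p : ℤ × ℤ // β + (p.2 : ℝ) ≠ 0},
      ee ((((α + (p.1.1 : ℝ)) * μ + (β + (p.1.2 : ℝ)) * ν : ℝ)) : ℂ) *
        ((((α + (p.1.1 : ℝ)) : ℝ) : ℂ) + (((β + (p.1.2 : ℝ)) : ℝ) : ℂ) * z) ^ (-s)) +
  dInt β *
    ((∑' m : {m : ℤ // 0 < α + (m : ℝ)},
        ee ((((α + (m.1 : ℝ)) * μ : ℝ)) : ℂ) * (((α + (m.1 : ℝ)) : ℝ) : ℂ) ^ (-s)) +
      Complex.cos ((Real.pi : ℂ) * s) *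
        ∑' m : {m : ℤ // α + (m : ℝ) < 0},
          ee ((((α + (m.1 : ℝ)) * μ : ℝ)) : ℂ) * ((|α + (m.1 : ℝ)| : ℝ) : ℂ) ^ (-s))

/-- `𝒜(s,α,μ) = cos(πs) ψ(s,-α,-μ) + ψ(s,α,μ)`. -/
def Acal (s : ℂ) (α μ : ℝ) : ℂ :=
  Complex.cos ((Real.pi : ℂ) * s) * psiL s (-α) (-μ) + psiL s α μ

/-- `ψ(k,γ,κ)` at an integer `k`: the convergent series for `k ≥ 2`, the value
`-𝒞_{1-k}(⟨γ⟩,κ)/(1-k) - δ_{k0} δ(γ)` of the analytic continuation for `k ≤ 0`,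
and the (irrelevant) value `0` for `k = 1`; here `C` is the family of Taylor
coefficients `𝒞`. -/
def psiIntC (C : ℕ → ℂ → ℝ → ℂ) (k : ℤ) (γ κ : ℝ) : ℂ :=
  if 2 ≤ k then
    ∑' n : {n : ℤ // 0 < γ + (n : ℝ)},
      ee ((((γ + (n.1 : ℝ)) * κ : ℝ)) : ℂ) * (((γ + (n.1 : ℝ)) : ℝ) : ℂ) ^ (-k)
  else if k ≤ 0 then
    -C (1 - k).toNat ((Int.fract γ : ℝ) : ℂ) κ / ((1 : ℂ) - (k : ℂ)) -
      (if k = 0 then dInt γ else 0)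
  else 0

/-- The Bernoulli polynomial `B_j(x)` evaluated in `ℂ`. -/
def BpolyC (j : ℕ) (x : ℂ) : ℂ := Polynomial.aeval x (Polynomial.bernoulli j)

/-- Weierstrass `℘`-function with periods `(1, z)`. -/
def wpFn (z w : ℂ) : ℂ :=
  w ^ (-2 : ℤ) + ∑' p : {p : ℤ × ℤ // p ≠ (0, 0)},
    ((w - (p.1.1 : ℂ) - (p.1.2 : ℂ) * z) ^ (-2 : ℤ) -
      ((p.1.1 : ℂ) + (p.1.2 : ℂ) * z) ^ (-2 : ℤ))

/-- Weierstrass zeta function with periods `(1, z)`. -/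
def wzetaFn (z w : ℂ) : ℂ :=
  1 / w + ∑' p : {p : ℤ × ℤ // p ≠ (0, 0)},
    (1 / (w - (p.1.1 : ℂ) - (p.1.2 : ℂ) * z) + 1 / ((p.1.1 : ℂ) + (p.1.2 : ℂ) * z) +
      w / ((p.1.1 : ℂ) + (p.1.2 : ℂ) * z) ^ 2)

/-- Weierstrass sigma function with periods `(1, z)`. -/
def wsigmaFn (z w : ℂ) : ℂ :=
  w * ∏' p : {p : ℤ × ℤ // p ≠ (0, 0)},
    ((1 - w / ((p.1.1 : ℂ) + (p.1.2 : ℂ) * z)) *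
      Complex.exp (w / ((p.1.1 : ℂ) + (p.1.2 : ℂ) * z) +
        w ^ 2 / (2 * ((p.1.1 : ℂ) + (p.1.2 : ℂ) * z) ^ 2)))

/-- The `q`-Pochhammer symbol `(Z;q)_∞`. -/
def qPoch (Z q : ℂ) : ℂ := ∏' l : ℕ, (1 - Z * q ^ l)

/-- `⟨x⟩' = 1 - ⟨-x⟩`. -/
def fracP (x : ℝ) : ℝ := 1 - Int.fract (-x)

/-- The Eisenstein series `E₂`. -/
def E2cl (z : ℂ) : ℂ := 1 - 24 * ∑' l : ℕ+, (l : ℂ) * ee z ^ (l : ℕ) / (1 - ee z ^ (l : ℕ))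

/-- `a_{2k}`: `ζ(1-2k)` for `k ≠ 0` and `2ζ'(0) = -log 2π` for `k = 0`. -/
def acoef (k : ℤ) : ℂ :=
  if k = 0 then -(Real.log (2 * Real.pi) : ℂ) else riemannZeta ((1 - 2 * k : ℤ) : ℂ)

/-- The classical Eisenstein series `E_{2k}`. -/
def Ecl (k : ℤ) (z : ℂ) : ℂ :=
  1 + (2 / acoef k) * ∑' l : ℕ+, (l : ℂ) ^ (2 * k - 1) * ee z ^ (l : ℕ) / (1 - ee z ^ (l : ℕ))

/-- The bilateral Lerch zeta function `ψ_ℤ^ε(r,γ,κ) = e^{-επir} ψ(r,-γ,-κ) + ψ(r,γ,κ)`. -/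
def psiZpm (ε : ℤ) (r : ℂ) (γ κ : ℝ) : ℂ :=
  Complex.exp (-(ε : ℂ) * (Real.pi : ℂ) * Complex.I * r) * psiL r (-γ) (-κ) + psiL r γ κ

/-- The `1`-periodic function `Σ_{m ∈ ℤ} (w + m)^{-2}`. -/
def invSqSum (w : ℂ) : ℂ := ∑' m : ℤ, ((w + (m : ℂ)) ^ 2)⁻¹

lemma summable_inv_add_int_sq (w : ℂ) : Summable fun m : ℤ ↦ ((w + (m : ℂ)) ^ 2)⁻¹ := by
  simpa using EisensteinSeries.linear_right_summable w 1 (k := 2) le_rfl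

lemma invSqSum_neg (w : ℂ) : invSqSum (-w) = invSqSum w := by
  rw [invSqSum, ← (Equiv.neg ℤ).tsum_eq]
  refine tsum_congr fun m ↦ ?_
  rw [Equiv.neg_apply, Int.cast_neg, ← neg_add, neg_sq]

lemma norm_ee (w : ℂ) : ‖ee w‖ = Real.exp (-(2 * π * w.im)) := by
  simp [ee, Complex.norm_exp]

lemma norm_ee_lt_one {w : ℂ} (hw : 0 < w.im) : ‖ee w‖ < 1 := by
  rw [norm_ee, Real.exp_lt_one_iff]
  have := Real.pi_pos
  have : 0 < π * w.im := by positivity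
  linarith

lemma invSqSum_eq_tsum {w : ℂ} (hw : 0 < w.im) :
    invSqSum w = -4 * (π : ℂ) ^ 2 * ∑' l : ℕ+, (l : ℂ) * ee w ^ (l : ℕ) := by
  have h := EisensteinSeries.qExpansion_identity_pnat (k := 1) le_rfl ⟨w, hw⟩
  simp only [one_div, Nat.reduceAdd, pow_one, Nat.factorial_one, Nat.cast_one, div_one] at h
  refine h.trans ?_
  rw [mul_pow, I_sq]
  simp only [ee]
  ring

lemma tsum_pnat_mul_pow {r : ℂ} (hr : ‖r‖ < 1) :
    ∑' l : ℕ+, (l : ℂ) * r ^ (l : ℕ) = r / (1 - r) ^ 2 := by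
  rw [← tsum_coe_mul_geometric_of_norm_lt_one hr,
    ← tsum_zero_pnat_eq_tsum_nat (hasSum_coe_mul_geometric_of_norm_lt_one hr).summable]
  simp

lemma invSqSum_eq_div {w : ℂ} (hw : 0 < w.im) :
    invSqSum w = -4 * (π : ℂ) ^ 2 * (ee w / (1 - ee w) ^ 2) := by
  rw [invSqSum_eq_tsum hw, tsum_pnat_mul_pow (norm_ee_lt_one hw)]

lemma invSqSum_eq_sin {w : ℂ} (hw : 0 < w.im) :
    invSqSum w = (π : ℂ) ^ 2 / Complex.sin (π * w) ^ 2 := by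
  rw [invSqSum_eq_div hw]
  have h1 : 1 - ee w ≠ 0 := fun h ↦ by
    have := norm_ee_lt_one hw
    rw [← sub_eq_zero.mp h] at this
    simp at this
  have hE := Complex.exp_ne_zero (π * w * I)
  have h2 : ee w = Complex.exp (π * w * I) ^ 2 := by
    rw [ee, ← Complex.exp_nat_mul]
    congr 1
    push_cast
    ring
  rw [Complex.sin, neg_mul (π * w : ℂ), Complex.exp_neg]
  rw [h2] at h1 ⊢
  have h3 : (Complex.exp (π * w * I))⁻¹ - Complex.exp (π * w * I) ≠ 0 := fun h ↦ h1 <| by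
    field_simp at h
    simpa using h
  have h4 : ((Complex.exp (π * w * I))⁻¹ - Complex.exp (π * w * I)) =
    (1 - Complex.exp (π * w * I) ^ 2) / Complex.exp (π * w * I) := by field_simp
  rw [h4]
  field_simp
  rw [I_sq]
  ring

lemma ofReal_add_intCast_ne_zero {α : ℝ} (hα : ¬ ∃ a : ℤ, (a : ℝ) = α) (m : ℤ) :
    (α : ℂ) + (m : ℂ) ≠ 0 := fun h ↦ hα ⟨-m, by
  have : α + (m : ℝ) = 0 := by exact_mod_cast h
  push_cast
  linarith⟩

lemma invSqSum_ofReal {α : ℝ} (hα : ¬ ∃ a : ℤ, (a : ℝ) = α) :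
    invSqSum α = (π : ℂ) ^ 2 / Complex.sin (π * α) ^ 2 := by
  have hsin : Complex.sin (π * α) ≠ 0 := by
    rw [Ne, Complex.sin_eq_zero_iff]
    rintro ⟨k, hk⟩
    rw [mul_comm (k : ℂ)] at hk
    exact hα ⟨k, by exact_mod_cast (mul_left_cancel₀ (by simp [Real.pi_ne_zero]) hk).symm⟩
  have hlim : Filter.Tendsto (fun ε : ℝ ↦ (α : ℂ) + ε * I) (nhdsWithin 0 (Set.Ioi 0))
      (nhds (α : ℂ)) := by
    have : Continuous fun ε : ℝ ↦ (α : ℂ) + ε * I := by fun_prop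
    simpa using (this.tendsto 0).mono_left nhdsWithin_le_nhds
  refine tendsto_nhds_unique (f := fun ε : ℝ ↦ invSqSum ((α : ℂ) + ε * I))
    (l := nhdsWithin 0 (Set.Ioi 0)) ?_ ?_
  · refine tendsto_tsum_of_dominated_convergence (summable_inv_add_int_sq α).norm
      (fun m ↦ ?_) (.of_forall fun ε m ↦ ?_)
    · exact ((hlim.add_const _).pow 2).inv₀ (pow_ne_zero 2 (ofReal_add_intCast_ne_zero hα m))
    · rw [norm_inv, norm_inv, norm_pow, norm_pow]
      have h0 := norm_pos_iff.mpr (ofReal_add_intCast_ne_zero hα m)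
      gcongr
      have := Complex.abs_re_le_norm ((α : ℂ) + ε * I + m)
      have h2 : (α : ℂ) + m = ((α + m : ℝ) : ℂ) := by push_cast; rfl
      rw [h2, Complex.norm_real, Real.norm_eq_abs]
      simpa using this
  · have hev : (fun ε : ℝ ↦ (π : ℂ) ^ 2 / Complex.sin (π * ((α : ℂ) + ε * I)) ^ 2)
        =ᶠ[nhdsWithin 0 (Set.Ioi 0)] fun ε ↦ invSqSum ((α : ℂ) + ε * I) := by
      filter_upwards [self_mem_nhdsWithin] with ε hε
      exact (invSqSum_eq_sin (by simpa using hε)).symm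
    refine Filter.Tendsto.congr' hev ?_
    refine tendsto_const_nhds.div (Filter.Tendsto.pow ?_ 2) (pow_ne_zero 2 hsin)
    exact (Complex.continuous_sin.tendsto _).comp (hlim.const_mul _)

/-- The positive integers as the index set of the inner sum of `Scal`. -/
def pnatEquivShiftZero : ℕ+ ≃ {l : ℤ // 0 < (0 : ℝ) + (l : ℝ)} where
  toFun l := ⟨(l : ℕ), by simp⟩
  invFun l := ⟨l.1.toNat, by have := l.2; simp at this; omega⟩
  left_inv l := PNat.eq (by simp)
  right_inv l := by
    have := l.2
    simp only [zero_add, Int.cast_pos] at this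
    ext
    simp [this.le]

lemma Scal_neg_one_eq_tsum (α β : ℝ) (z : ℂ) :
    Scal (-1) β 0 0 α (-I * z) =
      ∑' k : {k : ℤ // 0 < β + (k : ℝ)}, ∑' l : ℕ+, (l : ℂ) *
        ee ((α : ℂ) + ((β + (k.1 : ℝ) : ℝ) : ℂ) * z) ^ (l : ℕ) := by
  refine tsum_congr fun k ↦ ?_
  rw [← pnatEquivShiftZero.tsum_eq]
  refine tsum_congr fun l ↦ ?_
  have hl : ((pnatEquivShiftZero l).1 : ℝ) = (l : ℕ) := Int.cast_natCast _
  simp only [hl, ee, neg_neg, Complex.cpow_one, ← Complex.exp_nat_mul]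
  rw [mul_comm (Complex.exp _), mul_assoc, ← Complex.exp_add]
  push_cast
  ring_nf

/-- The integers `k` with `0 < β + k` form a half line. -/
def natEquivShiftPos (β : ℝ) : ℕ ≃ {k : ℤ // 0 < β + (k : ℝ)} where
  toFun n := ⟨⌊-β⌋ + 1 + n, by
    have := Int.lt_floor_add_one (-β)
    push_cast
    have : (0 : ℝ) ≤ n := n.cast_nonneg
    linarith⟩
  invFun k := (k.1 - (⌊-β⌋ + 1)).toNat
  left_inv n := by simp
  right_inv k := by
    have : ⌊-β⌋ < k.1 := Int.floor_lt.mpr (by linarith [k.2])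
    ext
    simp only []
    omega

lemma summable_invSqSum_pos {z : ℂ} (hz : 0 < z.im) (α β : ℝ) :
    Summable fun k : {k : ℤ // 0 < β + (k : ℝ)} ↦
      invSqSum ((α : ℂ) + ((β + (k.1 : ℝ) : ℝ) : ℂ) * z) := by
  rw [← (natEquivShiftPos β).summable_iff]
  set b : ℝ := β + ((⌊-β⌋ + 1 : ℤ) : ℝ) with hb
  have hb0 : 0 < b := by simpa [natEquivShiftPos, hb] using (natEquivShiftPos β 0).2
  set ρ : ℝ := Real.exp (-(2 * π * (b * z.im))) with hρ
  set q : ℝ := Real.exp (-(2 * π * z.im)) with hq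
  have hpi := Real.pi_pos
  have hρ1 : ρ < 1 := Real.exp_lt_one_iff.mpr (neg_neg_of_pos (by positivity))
  have hq1 : q < 1 := Real.exp_lt_one_iff.mpr (neg_neg_of_pos (by positivity))
  have key (n : ℕ) : ‖ee ((α : ℂ) + ((β + ((natEquivShiftPos β n).1 : ℝ) : ℝ) : ℂ) * z)‖
      = ρ * q ^ n := by
    rw [norm_ee, hρ, hq, ← Real.exp_nat_mul, ← Real.exp_add]
    congr 1
    simp [natEquivShiftPos, hb]
    ring
  refine Summable.of_norm_bounded (g := fun n : ℕ ↦ 4 * π ^ 2 * (ρ / (1 - ρ) ^ 2) * q ^ n)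
    ((summable_geometric_of_lt_one (Real.exp_nonneg _) hq1).mul_left _) fun n ↦ ?_
  have hk := (natEquivShiftPos β n).2
  rw [Function.comp_apply, invSqSum_eq_div (by simpa using mul_pos hk hz)]
  have hle : ρ * q ^ n ≤ ρ :=
    mul_le_of_le_one_right (Real.exp_nonneg _) (pow_le_one₀ (Real.exp_nonneg _) hq1.le)
  have hden : 1 - ρ ≤ ‖1 - ee ((α : ℂ) + ((β + ((natEquivShiftPos β n).1 : ℝ) : ℝ) : ℂ) * z)‖ := by
    have := norm_sub_norm_le (1 : ℂ)
      (ee ((α : ℂ) + ((β + ((natEquivShiftPos β n).1 : ℝ) : ℝ) : ℂ) * z))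
    rw [key, norm_one] at this
    linarith
  rw [norm_mul, norm_div, norm_pow, key]
  have h4 : ‖-4 * (π : ℂ) ^ 2‖ = 4 * π ^ 2 := by simp
  rw [h4, mul_assoc (4 * π ^ 2), div_mul_eq_mul_div]
  have : 0 < 1 - ρ := by linarith
  have : 0 ≤ ρ * q ^ n := by positivity
  gcongr

lemma hasSum_invSqSum_pos {z : ℂ} (hz : 0 < z.im) (α β : ℝ) :
    HasSum (fun k : {k : ℤ // 0 < β + (k : ℝ)} ↦
      invSqSum ((α : ℂ) + ((β + (k.1 : ℝ) : ℝ) : ℂ) * z))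
      (-4 * (π : ℂ) ^ 2 * Scal (-1) β 0 0 α (-I * z)) := by
  convert (summable_invSqSum_pos hz α β).hasSum using 1
  rw [Scal_neg_one_eq_tsum, ← tsum_mul_left]
  exact tsum_congr fun k ↦ (invSqSum_eq_tsum (by simpa using mul_pos k.2 hz)).symm

lemma hasSum_invSqSum_neg {z : ℂ} (hz : 0 < z.im) (α β : ℝ) :
    HasSum (fun k : {k : ℤ // β + (k : ℝ) < 0} ↦
      invSqSum ((α : ℂ) + ((β + (k.1 : ℝ) : ℝ) : ℂ) * z))
      (-4 * (π : ℂ) ^ 2 * Scal (-1) (-β) 0 0 (-α) (-I * z)) := by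
  let e : {k : ℤ // β + (k : ℝ) < 0} ≃ {k : ℤ // 0 < -β + (k : ℝ)} :=
    (Equiv.neg ℤ).subtypeEquiv fun k ↦ by
      rw [Equiv.neg_apply, Int.cast_neg, ← neg_add, neg_pos]
  have h := e.hasSum_iff.mpr (hasSum_invSqSum_pos hz (-α) (-β))
  convert h using 1
  funext k
  rw [Function.comp_apply, ← invSqSum_neg]
  congr 1
  simp only [e, Equiv.subtypeEquiv_apply, Equiv.neg_apply]
  push_cast
  ring

lemma hasSum_invSqSum_zero (z : ℂ) (α β : ℝ) :
    HasSum (fun k : {k : ℤ // β + (k : ℝ) = 0} ↦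
      invSqSum ((α : ℂ) + ((β + (k.1 : ℝ) : ℝ) : ℂ) * z)) (dInt β * invSqSum α) := by
  have hval (k : {k : ℤ // β + (k : ℝ) = 0}) :
      invSqSum ((α : ℂ) + ((β + (k.1 : ℝ) : ℝ) : ℂ) * z) = invSqSum α := by
    rw [k.2, ofReal_zero, zero_mul, add_zero]
  simp only [hval]
  by_cases h : ∃ n : ℤ, (n : ℝ) = β
  · obtain ⟨n, hn⟩ := h
    have hu : Unique {k : ℤ // β + (k : ℝ) = 0} :=
      { default := ⟨-n, by simp [hn]⟩
        uniq := fun k ↦ by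
          have h0 : (k.1 : ℝ) = ((-n : ℤ) : ℝ) := by push_cast; linarith [k.2]
          exact Subtype.ext (by exact_mod_cast h0) }
    simp [dInt, show ∃ n : ℤ, (n : ℝ) = β from ⟨n, hn⟩]
  · have : IsEmpty {k : ℤ // β + (k : ℝ) = 0} :=
      ⟨fun k ↦ h ⟨-k.1, by push_cast; linarith [k.2]⟩⟩
    simp [dInt, h]

/-- The sum of the rows `Σ_m (α + (β + k) z + m)^{-2}` over all `k`; the row `β + k = 0`, if there is
one, contributes `invSqSum α`. -/
lemma hasSum_invSqSum {z : ℂ} (hz : 0 < z.im) (α β : ℝ) :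
    HasSum (fun k : ℤ ↦ invSqSum ((α : ℂ) + ((β + (k : ℝ) : ℝ) : ℂ) * z))
      (dInt β * invSqSum α - 4 * (π : ℂ) ^ 2 *
        (Scal (-1) β 0 0 α (-I * z) + Scal (-1) (-β) 0 0 (-α) (-I * z))) := by
  let f := fun k : ℤ ↦ invSqSum ((α : ℂ) + ((β + (k : ℝ) : ℝ) : ℂ) * z)
  have hdisj : Disjoint {k : ℤ | 0 < β + (k : ℝ)} {k : ℤ | β + (k : ℝ) < 0} :=
    Set.disjoint_left.mpr fun k (h : 0 < β + (k : ℝ)) ↦ h.le.not_gt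
  have hcompl : IsCompl ({k : ℤ | 0 < β + (k : ℝ)} ∪ {k : ℤ | β + (k : ℝ) < 0})
      {k : ℤ | β + (k : ℝ) = 0} := by
    refine ⟨Set.disjoint_left.mpr ?_, codisjoint_iff.mpr (Set.eq_univ_of_forall fun k ↦ ?_)⟩
    · rintro k (h | h) h0
      exacts [h.ne' h0, h.ne h0]
    · rcases lt_trichotomy (β + (k : ℝ)) 0 with h | h | h
      exacts [.inl (.inr h), .inr h, .inl (.inl h)]
  have h1 : HasSum (f ∘ (Subtype.val : {k : ℤ | 0 < β + (k : ℝ)} → ℤ)) _ :=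
    hasSum_invSqSum_pos hz α β
  have h2 : HasSum (f ∘ (Subtype.val : {k : ℤ | β + (k : ℝ) < 0} → ℤ)) _ :=
    hasSum_invSqSum_neg hz α β
  have h3 : HasSum (f ∘ (Subtype.val : {k : ℤ | β + (k : ℝ) = 0} → ℤ)) _ :=
    hasSum_invSqSum_zero z α β
  convert (h1.add_disjoint hdisj h2).add_isCompl hcompl h3 using 1
  ring

lemma E2cl_eq_E2 {z : ℂ} (hz : 0 < z.im) : E2cl z = EisensteinSeries.E2 ⟨z, hz⟩ := by
  have h := tsum_pow_div_one_sub_eq_tsum_sigma (norm_ee_lt_one hz) 1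
  simp only [pow_one] at h
  rw [E2cl, h, EisensteinSeries.E2_eq_tsum_cexp]
  rfl

lemma hasSum_invSqSum_int_mul {z : ℂ} (hz : 0 < z.im) :
    HasSum (fun n : ℤ ↦ invSqSum (n * z)) ((π : ℂ) ^ 2 / 3 * E2cl z) := by
  have hs : Summable fun n : ℤ ↦ invSqSum (n * z) := by
    simpa using (hasSum_invSqSum hz 0 0).summable
  have hG : HasSum (fun n : ℤ ↦ invSqSum (n * z)) (EisensteinSeries.G2 ⟨z, hz⟩)
      (SummationFilter.symmetricIcc ℤ) := by
    have := EisensteinSeries.hasSum_e2Summand_symmetricIcc ⟨z, hz⟩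
    rw [← EisensteinSeries.G2_eq_tsum_cexp] at this
    convert this using 2 with n
    simp [invSqSum, EisensteinSeries.e2Summand, EisensteinSeries.eisSummand]
  have hE : (π : ℂ) ^ 2 / 3 * E2cl z = EisensteinSeries.G2 ⟨z, hz⟩ := by
    rw [E2cl_eq_E2 hz, EisensteinSeries.E2]
    have := Real.pi_ne_zero
    simp [riemannZeta_two]
    field_simp
    norm_num
  rw [hE, ← hG.tsum_eq, tsum_eq_of_summable_unconditional hs]
  exact hs.hasSum

/-- The pair of periods `(1, z)`. -/
def periodPairOne {z : ℂ} (hz : 0 < z.im) : PeriodPair where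
  ω₁ := 1
  ω₂ := z
  indep := by
    refine LinearIndependent.pair_iff.mpr fun s t h ↦ ?_
    have h1 := congrArg Complex.im h
    have h2 := congrArg Complex.re h
    simp [hz.ne'] at h1 h2
    simp_all

lemma summable_wp {z : ℂ} (hz : 0 < z.im) (w : ℂ) :
    Summable fun p : ℤ × ℤ ↦ ((w - (p.1 : ℂ) - (p.2 : ℂ) * z) ^ (-2 : ℤ) -
      ((p.1 : ℂ) + (p.2 : ℂ) * z) ^ (-2 : ℤ)) := by
  have h := ((periodPairOne hz).latticeEquivProd.symm.toEquiv.summable_iff).mpr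
    ((periodPairOne hz).hasSum_weierstrassP w).summable
  refine h.congr fun p ↦ ?_
  have := (periodPairOne hz).latticeEquiv_symm_apply p
  simp only [Function.comp_apply, LinearEquiv.coe_toEquiv, this]
  simp [periodPairOne, zpow_neg, sub_sub]

lemma wpFn_eq_tsum {z : ℂ} (hz : 0 < z.im) (w : ℂ) :
    wpFn z w = ∑' p : ℤ × ℤ, ((w - (p.1 : ℂ) - (p.2 : ℂ) * z) ^ (-2 : ℤ) -
      ((p.1 : ℂ) + (p.2 : ℂ) * z) ^ (-2 : ℤ)) := by
  rw [(summable_wp hz w).tsum_eq_add_tsum_ite (0, 0), wpFn]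
  congr 1
  · simp
  · refine (tsum_subtype {p : ℤ × ℤ | p ≠ (0, 0)} fun p : ℤ × ℤ ↦
      ((w - (p.1 : ℂ) - (p.2 : ℂ) * z) ^ (-2 : ℤ) -
        ((p.1 : ℂ) + (p.2 : ℂ) * z) ^ (-2 : ℤ))).trans ?_
    refine tsum_congr fun p ↦ ?_
    by_cases hp : p = (0, 0) <;> simp [hp]

lemma hasSum_zpow_row (w z : ℂ) (n : ℤ) :
    HasSum (fun m : ℤ ↦ (w - (m : ℂ) - (n : ℂ) * z) ^ (-2 : ℤ)) (invSqSum (w - n * z)) := by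
  have h := (Equiv.neg ℤ).hasSum_iff.mpr (summable_inv_add_int_sq (w - n * z)).hasSum
  refine h.congr_fun fun m ↦ ?_
  rw [Function.comp_apply, Equiv.neg_apply, Int.cast_neg, zpow_neg, zpow_ofNat]
  ring

lemma tsum_wp_row (w z : ℂ) (n : ℤ) :
    ∑' m : ℤ, ((w - (m : ℂ) - (n : ℂ) * z) ^ (-2 : ℤ) - ((m : ℂ) + (n : ℂ) * z) ^ (-2 : ℤ)) =
      invSqSum (w - n * z) - invSqSum (n * z) := by
  have h : HasSum (fun m : ℤ ↦ ((m : ℂ) + n * z) ^ (-2 : ℤ)) (invSqSum (n * z)) := by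
    refine (summable_inv_add_int_sq (n * z)).hasSum.congr_fun fun m ↦ ?_
    rw [zpow_neg, zpow_ofNat, add_comm]
  exact ((hasSum_zpow_row w z n).sub h).tsum_eq

lemma hasSum_invSqSum_sub {z : ℂ} (hz : 0 < z.im) (α β : ℝ) :
    HasSum (fun n : ℤ ↦ invSqSum ((α : ℂ) + β * z - n * z))
      (dInt β * invSqSum α - 4 * (π : ℂ) ^ 2 *
        (Scal (-1) β 0 0 α (-I * z) + Scal (-1) (-β) 0 0 (-α) (-I * z))) := by
  refine ((Equiv.neg ℤ).hasSum_iff.mpr (hasSum_invSqSum hz α β)).congr_fun fun n ↦ ?_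
  rw [Function.comp_apply, Equiv.neg_apply]
  push_cast
  ring_nf

/-- Corollary 4.7 of the paper: the `q`-expansion of Weierstrass' `℘`-function. -/
theorem statement10 (z : ℂ) (hz : 0 < z.im) (α β : ℝ)
    (hαβ : ¬((∃ a : ℤ, (a : ℝ) = α) ∧ (∃ b : ℤ, (b : ℝ) = β))) :
    wpFn z ((α : ℂ) + (β : ℂ) * z) =
      -((Real.pi : ℂ) ^ 2 / 3) * E2cl z +
        dInt β * (Real.pi : ℂ) ^ 2 / Complex.sin ((Real.pi : ℂ) * (α : ℂ)) ^ 2 -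
        4 * (Real.pi : ℂ) ^ 2 *
          (Scal (-1) β 0 0 α (-Complex.I * z) + Scal (-1) (-β) 0 0 (-α) (-Complex.I * z)) := by
  have hs := (Equiv.prodComm ℤ ℤ).summable_iff.mpr (summable_wp hz (α + β * z))
  have hsin : dInt β * invSqSum α = dInt β * (π : ℂ) ^ 2 / Complex.sin (π * α) ^ 2 := by
    by_cases hβ : ∃ n : ℤ, (n : ℝ) = β
    · rw [invSqSum_ofReal fun hα ↦ hαβ ⟨hα, hβ⟩, mul_div_assoc]
    · simp [dInt, hβ]
  rw [wpFn_eq_tsum hz, ← (Equiv.prodComm ℤ ℤ).tsum_eq]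
  refine hs.tsum_prod.trans ?_
  simp only [Function.comp_apply, Equiv.prodComm_apply, Prod.fst_swap, Prod.snd_swap, tsum_wp_row]
  rw [((hasSum_invSqSum_sub hz α β).sub (hasSum_invSqSum_int_mul hz)).tsum_eq, hsin]
  ring

end
end

section
/- Let z ∈ ℂ with Im z > 0 and let p := e(z/2) = e^{πiz}. Define the Weierstrassian invariants e₁(1,z) := ℘(1/2 | 1,z), e₂(1,z) := ℘(z/2 | 1,z), e₃(1,z) := ℘((1+z)/2 | 1,z). Then: e₁(1,z) = 4π²·( 1/6 + 4·Σ_{l≥1} (2l−1)·p^{4l−2}/(1−p^{4l−2}) ); e₂(1,z) = 4π²·( −1/12 − 2·Σ_{l≥1} (2l−1)·p^{2l−1}/(1−p^{2l−1}) ); e₃(1,z) = 4π²·( −1/12 + 2·Σ_{l≥1} (2l−1)·p^{2l−1}/(1+p^{2l−1}) ). -/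
noncomputable section

open Complex MeasureTheory
open scoped Real Classical

/-- The odd part of a series over the positive integers, indexed by the natural numbers. -/
lemma hasSum_pnat_odd_iff {f : ℕ → ℂ} {a : ℂ} :
    HasSum (fun l : ℕ+ ↦ f (2 * l - 1)) a ↔ HasSum (fun n : ℕ ↦ f (2 * n + 1)) a := by
  rw [← Equiv.pnatEquivNat.symm.hasSum_iff]
  have (n : ℕ) : 2 * (n + 1) - 1 = 2 * n + 1 := by lia
  simp only [Function.comp_def, Equiv.pnatEquivNat_symm_apply, Nat.succPNat_coe,
    Nat.succ_eq_add_one, this]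

/-- Summability of the odd part of a series over the positive integers. -/
lemma summable_pnat_odd {f : ℕ → ℂ} (hf : Summable fun k : ℕ+ ↦ f k) :
    Summable fun l : ℕ+ ↦ f (2 * l - 1) := by
  have hs : Summable f := summable_pnat_iff_summable_nat.mp hf
  have hodd : Summable fun n : ℕ ↦ f (2 * n + 1) :=
    hs.comp_injective (i := fun n : ℕ ↦ 2 * n + 1) fun a b h ↦ by simpa using h
  exact (hasSum_pnat_odd_iff.mpr hodd.hasSum).summable

/-- Summability of the even part of a series over the positive integers. -/
lemma summable_pnat_even {f : ℕ → ℂ} (hf : Summable fun k : ℕ+ ↦ f k) :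
    Summable fun l : ℕ+ ↦ f (2 * l) :=
  hf.comp_injective (i := fun l : ℕ+ ↦ 2 * l) fun a b h ↦ by simpa using h

/-- A series over the positive integers splits into its even and odd parts. -/
lemma tsum_pnat_eq_even_add_odd {f : ℕ → ℂ} (hf : Summable fun k : ℕ+ ↦ f k) :
    ∑' k : ℕ+, f k = ∑' l : ℕ+, f (2 * l) + ∑' l : ℕ+, f (2 * l - 1) := by
  have hs : Summable f := summable_pnat_iff_summable_nat.mp hf
  have heven : Summable fun n : ℕ ↦ f (2 * n) :=
    hs.comp_injective (i := fun n : ℕ ↦ 2 * n) fun a b h ↦ by simpa using h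
  have hodd := hasSum_pnat_odd_iff.mp (summable_pnat_odd hf).hasSum
  have h1 := tsum_zero_pnat_eq_tsum_nat hs
  have h2 := tsum_zero_pnat_eq_tsum_nat heven
  rw [mul_zero] at h2
  linear_combination h1 - h2 + (heven.hasSum.even_add_odd hodd).tsum_eq

/-- Shifting the odd part of a series over the positive integers. -/
lemma tsum_pnat_odd_shift {f : ℕ → ℂ} (hf : Summable fun k : ℕ+ ↦ f k) :
    ∑' l : ℕ+, f (2 * l - 1) = f 1 + ∑' l : ℕ+, f (2 * l + 1) := by
  have h := hasSum_pnat_odd_iff.mp (summable_pnat_odd hf).hasSum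
  have h1 := tsum_zero_pnat_eq_tsum_nat h.summable
  rw [← h.tsum_eq, ← h1, mul_zero, zero_add]

lemma summable_pnat_odd_shift {f : ℕ → ℂ} (hf : Summable fun k : ℕ+ ↦ f k) :
    Summable fun l : ℕ+ ↦ f (2 * l + 1) := by
  have h := hasSum_pnat_odd_iff (f := f) |>.mp (summable_pnat_odd hf).hasSum
  exact (summable_pnat_iff_summable_nat (f := fun l ↦ f (2 * l + 1))).mpr h.summable

lemma tsum_pnat_pow {y : ℂ} (hy : ‖y‖ < 1) : ∑' n : ℕ+, y ^ (n : ℕ) = y / (1 - y) := by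
  have h := tsum_geometric_of_norm_lt_one hy
  rw [← tsum_zero_pnat_eq_tsum_nat (f := fun n ↦ y ^ n)
    (summable_geometric_of_norm_lt_one hy)] at h
  have : 1 - y ≠ 0 := sub_ne_zero.mpr fun h ↦ by simp [← h] at hy
  rw [pow_zero] at h
  rw [← add_right_inj (1 : ℂ), h]
  field_simp
  ring

/-- Absolute convergence of the double series underlying a twisted Lambert series. -/
lemma summable_lambert {q c d : ℂ} (hq : ‖q‖ < 1) (hc : ‖c‖ ≤ 1) (hd : ‖d‖ ≤ 1) :
    Summable fun x : ℕ+ × ℕ+ ↦ d ^ (x.1 : ℕ) * ((x.2 : ℂ) * c ^ (x.2 : ℕ) *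
      (q ^ (x.1 : ℕ)) ^ (x.2 : ℕ)) := by
  refine Summable.of_norm_bounded (summable_prod_mul_pow 1 hq).norm fun x ↦ ?_
  have h1 : ‖c‖ ^ (x.2 : ℕ) ≤ 1 := pow_le_one₀ (norm_nonneg _) hc
  have h2 : ‖d‖ ^ (x.1 : ℕ) ≤ 1 := pow_le_one₀ (norm_nonneg _) hd
  rw [← pow_mul]
  simp only [norm_mul, norm_pow, pow_one]
  calc _ = (‖c‖ ^ (x.2 : ℕ) * ‖d‖ ^ (x.1 : ℕ)) * (‖(x.2 : ℂ)‖ * ‖q‖ ^ (x.1 * x.2 : ℕ)) := by ring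
    _ ≤ 1 * (‖(x.2 : ℂ)‖ * ‖q‖ ^ (x.1 * x.2 : ℕ)) := by
      gcongr
      exact mul_le_one₀ h1 (by positivity) h2
    _ = _ := one_mul _

lemma lambert_inner {q d : ℂ} (hq : ‖q‖ < 1) (hd : ‖d‖ ≤ 1) (c : ℂ) (k : ℕ+) :
    ∑' m : ℕ+, d ^ (m : ℕ) * ((k : ℂ) * c ^ (k : ℕ) * (q ^ (m : ℕ)) ^ (k : ℕ)) =
      c ^ (k : ℕ) * ((k : ℂ) * (d * q ^ (k : ℕ)) / (1 - d * q ^ (k : ℕ))) := by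
  have h : ‖d * q ^ (k : ℕ)‖ < 1 := by
    rw [norm_mul, norm_pow]
    exact (mul_le_of_le_one_left (by positivity) hd).trans_lt
      (pow_lt_one₀ (norm_nonneg _) hq k.ne_zero)
  rw [mul_div_assoc, ← tsum_pnat_pow h, ← tsum_mul_left, ← tsum_mul_left]
  refine tsum_congr fun m ↦ ?_
  rw [mul_pow, ← pow_mul, ← pow_mul, mul_comm (m : ℕ)]
  ring

/-- Summing the double series in the other order gives a Lambert series. -/
lemma tsum_lambert {q c d : ℂ} (hq : ‖q‖ < 1) (hc : ‖c‖ ≤ 1) (hd : ‖d‖ ≤ 1) :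
    ∑' m : ℕ+, d ^ (m : ℕ) * ∑' k : ℕ+, (k : ℂ) * c ^ (k : ℕ) * (q ^ (m : ℕ)) ^ (k : ℕ) =
      ∑' k : ℕ+, c ^ (k : ℕ) * ((k : ℂ) * (d * q ^ (k : ℕ)) / (1 - d * q ^ (k : ℕ))) := by
  simp_rw [← tsum_mul_left]
  rw [← Summable.tsum_comm (f := fun m k : ℕ+ ↦ d ^ (m : ℕ) * ((k : ℂ) * c ^ (k : ℕ) *
    (q ^ (m : ℕ)) ^ (k : ℕ))) (summable_lambert hq hc hd)]
  exact tsum_congr fun k ↦ lambert_inner hq hd c k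

lemma summable_lambert_outer {q c d : ℂ} (hq : ‖q‖ < 1) (hc : ‖c‖ ≤ 1) (hd : ‖d‖ ≤ 1) :
    Summable fun m : ℕ+ ↦
      d ^ (m : ℕ) * ∑' k : ℕ+, (k : ℂ) * c ^ (k : ℕ) * (q ^ (m : ℕ)) ^ (k : ℕ) := by
  simpa only [tsum_mul_left] using (summable_lambert hq hc hd).prod

lemma summable_lambert_series {q c d : ℂ} (hq : ‖q‖ < 1) (hc : ‖c‖ ≤ 1) (hd : ‖d‖ ≤ 1) :
    Summable fun k : ℕ+ ↦
      c ^ (k : ℕ) * ((k : ℂ) * (d * q ^ (k : ℕ)) / (1 - d * q ^ (k : ℕ))) :=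
  (summable_lambert hq hc hd).prod_symm.prod.congr fun k ↦ lambert_inner hq hd c k

/-- The lattice sum `∑_{m ∈ ℤ} (u + m)⁻²`, omitting the undefined term when `u` is an integer. -/
def intSqSum (u : ℂ) : ℂ := ∑' m : ℤ, 1 / (u + m) ^ 2

lemma summable_intSqSum (u : ℂ) : Summable fun m : ℤ ↦ 1 / (u + m) ^ 2 := by
  simpa using! EisensteinSeries.linear_right_summable u 1 (k := 2) le_rfl

lemma intSqSum_neg (u : ℂ) : intSqSum (-u) = intSqSum u := by
  rw [intSqSum, ← (Equiv.neg ℤ).tsum_eq]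
  refine tsum_congr fun m ↦ ?_
  rw [← neg_sq (u + m)]
  simp [add_comm]

lemma intSqSum_add_int (u : ℂ) (n : ℤ) : intSqSum (u + n) = intSqSum u := by
  rw [intSqSum, intSqSum, ← (Equiv.addLeft n).tsum_eq (fun m : ℤ ↦ 1 / (u + m) ^ 2)]
  refine tsum_congr fun m ↦ ?_
  simp [add_assoc]

lemma intSqSum_eq_tsum_exp {u : ℂ} (hu : 0 < u.im) :
    intSqSum u = -4 * (π : ℂ) ^ 2 * ∑' k : ℕ+, (k : ℂ) * cexp (2 * π * I * u) ^ (k : ℕ) := by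
  have h := EisensteinSeries.qExpansion_identity_pnat (k := 1) le_rfl ⟨u, hu⟩
  simp only [Nat.factorial_one, Nat.cast_one, div_one, pow_one] at h
  rw [intSqSum, h]
  congr 1
  rw [mul_pow, I_sq]
  ring

lemma intSqSum_zero : intSqSum 0 = (π : ℂ) ^ 2 / 3 := by
  have h := two_mul_riemannZeta_eq_tsum_int_inv_pow_of_even (k := 2) le_rfl even_two
  simp only [Nat.cast_ofNat, riemannZeta_two] at h
  simp only [intSqSum, zero_add, one_div]
  rw [← h]
  ring

lemma hasSum_inv_odd_sq : HasSum (fun n : ℕ ↦ 1 / (2 * (n : ℂ) + 1) ^ 2) ((π : ℂ) ^ 2 / 8) := by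
  set f : ℕ → ℂ := fun n ↦ 1 / (n : ℂ) ^ 2 with hf
  have h : HasSum f ((π : ℂ) ^ 2 / 6) := by
    simpa [hf] using! Complex.hasSum_ofReal.mpr hasSum_zeta_two
  have he : HasSum (fun n : ℕ ↦ f (2 * n)) ((π : ℂ) ^ 2 / 24) := by
    convert! h.mul_left (1 / 4 : ℂ) using 1
    · ext n
      simp only [hf, Nat.cast_mul, Nat.cast_ofNat]
      field
    · ring
  have ho : Summable fun n : ℕ ↦ f (2 * n + 1) :=
    h.summable.comp_injective (i := fun n : ℕ ↦ 2 * n + 1) fun a b h ↦ by simpa using h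
  have hv : ∑' n : ℕ, f (2 * n + 1) = (π : ℂ) ^ 2 / 8 := by
    linear_combination (he.even_add_odd ho.hasSum).unique h
  rw [← hv]
  simpa [hf] using ho.hasSum

lemma intSqSum_half : intSqSum (1 / 2) = (π : ℂ) ^ 2 := by
  have h : HasSum (fun n : ℕ ↦ 1 / (1 / 2 + (n : ℂ)) ^ 2) ((π : ℂ) ^ 2 / 2) := by
    convert! hasSum_inv_odd_sq.mul_left 4 using 1
    · ext n
      rw [show (2 * (n : ℂ) + 1) = 2 * (1 / 2 + n) by ring, mul_pow]
      field
    · ring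
  have := HasSum.of_nat_of_neg_add_one (f := fun m : ℤ ↦ 1 / (1 / 2 + (m : ℂ)) ^ 2)
    (by simpa using h) (m' := (π : ℂ) ^ 2 / 2) (by
      convert! h using 2 with n
      push_cast
      rw [← neg_sq]
      ring)
  rw [intSqSum, this.tsum_eq]
  ring

lemma linearIndependent_one_of_im_pos {z : ℂ} (hz : 0 < z.im) :
    LinearIndependent ℝ ![(1 : ℂ), z] := by
  refine LinearIndependent.pair_iff.mpr fun s t h ↦ ?_
  have ht : t = 0 := by simpa [hz.ne'] using congrArg Complex.im h
  refine ⟨?_, ht⟩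
  simpa [ht] using congrArg Complex.re h

lemma hasSum_wpFn {z : ℂ} (hz : 0 < z.im) (w : ℂ) :
    HasSum (fun x : ℤ × ℤ ↦ 1 / (w - (x.1 + x.2 * z)) ^ 2 - 1 / ((x.1 : ℂ) + x.2 * z) ^ 2)
      (wpFn z w) := by
  set f : ℤ × ℤ → ℂ :=
    fun x ↦ 1 / (w - (x.1 + x.2 * z)) ^ 2 - 1 / ((x.1 : ℂ) + x.2 * z) ^ 2 with hf
  let L : PeriodPair := ⟨1, z, linearIndependent_one_of_im_pos hz⟩
  have hs : Summable f := by
    convert! L.latticeEquivProd.symm.toEquiv.summable_iff.mpr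
      (L.hasSumLocallyUniformly_weierstrassP.hasSum (x := w)).summable using 2
    ext x
    have hx : ((L.latticeEquivProd.symm x : L.lattice) : ℂ) = x.1 + x.2 * z := by
      rw [L.latticeEquiv_symm_apply]
      simp [L]
    simp [hf, ← hx]
  have h0 : f (0, 0) = w ^ (-2 : ℤ) := by
    simp [hf, zpow_neg]
  convert! hs.hasSum using 1
  rw [hs.tsum_eq_add_tsum_ite (0, 0), h0, wpFn]
  congr 1
  rw [← tsum_subtype_eq_of_support_subset (s := {x | x ≠ (0, 0)}) fun x hx h ↦ by simp [h] at hx]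
  refine tsum_congr fun x ↦ ?_
  rw [if_neg x.2]
  simp only [hf, zpow_neg, ← sub_sub, one_div]
  rfl

/-- Summing the Weierstrass series along the rows of the lattice. -/
lemma hasSum_intSqSum_sub {z : ℂ} (hz : 0 < z.im) (w : ℂ) :
    HasSum (fun n : ℤ ↦ intSqSum (w - n * z) - intSqSum (n * z)) (wpFn z w) := by
  refine ((Equiv.prodComm ℤ ℤ).hasSum_iff.mpr (hasSum_wpFn hz w)).prod_fiberwise fun n ↦ ?_
  have h1 := (summable_intSqSum (n * z - w)).hasSum
  have h2 := (summable_intSqSum (n * z)).hasSum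
  rw [← intSqSum_neg (w - n * z), neg_sub]
  convert! h1.sub h2 using 2 with m
  simp only [Function.comp_apply, Equiv.prodComm_apply, Prod.fst_swap, Prod.snd_swap]
  rw [← neg_sq]
  ring_nf

lemma wpFn_eq {z : ℂ} (hz : 0 < z.im) (w : ℂ) :
    wpFn z w = intSqSum w - (π : ℂ) ^ 2 / 3 +
      ∑' n : ℕ+, (intSqSum (n * z - w) - intSqSum (n * z)) +
      ∑' n : ℕ+, (intSqSum (n * z + w) - intSqSum (n * z)) := by
  have h := hasSum_intSqSum_sub hz w
  rw [← h.tsum_eq, tsum_int_eq_zero_add_tsum_pnat h.summable]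
  congr 1
  · congr 1
    · simp [intSqSum_zero]
    · refine tsum_congr fun n ↦ ?_
      rw [← intSqSum_neg (n * z - w), neg_sub]
      simp
  · refine tsum_congr fun n ↦ ?_
    rw [← intSqSum_neg (n * z)]
    congr 2
    · push_cast
      ring
    · push_cast
      ring

lemma wpFn_add_one {z : ℂ} (hz : 0 < z.im) (w : ℂ) : wpFn (z + 1) w = wpFn z w := by
  refine HasSum.unique (hasSum_intSqSum_sub (by simpa using hz) w) ?_
  convert! hasSum_intSqSum_sub hz w using 3 with n
  · rw [← intSqSum_add_int _ n]
    ring_nf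
  · rw [← intSqSum_add_int (n * z) n]
    ring_nf

lemma norm_exp_pi_mul_I_lt_one {z : ℂ} (hz : 0 < z.im) : ‖cexp (π * I * z)‖ < 1 := by
  rw [norm_exp, Real.exp_lt_one_iff]
  simpa using mul_pos Real.pi_pos hz

lemma wpFn_half {z : ℂ} (hz : 0 < z.im) :
    wpFn z (1 / 2) = 4 * (π : ℂ) ^ 2 * (1 / 6 + 4 * ∑' l : ℕ+, ((2 * (l : ℕ) : ℕ) - 1 : ℂ) *
      cexp (π * I * z) ^ (4 * (l : ℕ) - 2) / (1 - cexp (π * I * z) ^ (4 * (l : ℕ) - 2))) := by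
  set p := cexp (π * I * z) with hp
  have hp1 : ‖p‖ < 1 := norm_exp_pi_mul_I_lt_one hz
  have hq : ‖p ^ 2‖ < 1 := by
    rw [norm_pow]
    exact pow_lt_one₀ (norm_nonneg _) hp1 two_ne_zero
  have him (n : ℕ+) : 0 < ((n : ℂ) * z).im := by simpa using hz
  have h0 (n : ℕ+) : intSqSum (n * z) = -4 * (π : ℂ) ^ 2 *
      (1 ^ (n : ℕ) * ∑' k : ℕ+, (k : ℂ) * 1 ^ (k : ℕ) * ((p ^ 2) ^ (n : ℕ)) ^ (k : ℕ)) := by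
    rw [intSqSum_eq_tsum_exp (him n)]
    have : cexp (2 * π * I * (n * z)) = (p ^ 2) ^ (n : ℕ) := by
      rw [hp, ← exp_nat_mul, ← exp_nat_mul]
      push_cast
      ring_nf
    simp only [this, one_pow, mul_one, one_mul]
  have h1 (n : ℕ+) : intSqSum (n * z + 1 / 2) = -4 * (π : ℂ) ^ 2 *
      (1 ^ (n : ℕ) * ∑' k : ℕ+, (k : ℂ) * (-1) ^ (k : ℕ) * ((p ^ 2) ^ (n : ℕ)) ^ (k : ℕ)) := by
    rw [intSqSum_eq_tsum_exp (by simpa using hz)]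
    have : cexp (2 * π * I * (n * z + 1 / 2)) = -1 * (p ^ 2) ^ (n : ℕ) := by
      rw [hp, ← exp_nat_mul, ← exp_nat_mul, ← exp_pi_mul_I, ← exp_add]
      push_cast
      ring_nf
    rw [this]
    simp only [one_pow, one_mul, mul_pow (-1 : ℂ), mul_assoc]
  have h2 (n : ℕ+) : intSqSum (n * z - 1 / 2) = intSqSum (n * z + 1 / 2) := by
    rw [← intSqSum_add_int _ 1]
    push_cast
    ring_nf
  set f : ℕ → ℂ := fun k ↦ (k : ℂ) * (1 * (p ^ 2) ^ k) / (1 - 1 * (p ^ 2) ^ k) with hf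
  have hs0 : Summable fun k : ℕ+ ↦ 1 ^ (k : ℕ) * f k :=
    summable_lambert_series hq norm_one.le norm_one.le
  have hs1 : Summable fun k : ℕ+ ↦ (-1) ^ (k : ℕ) * f k :=
    summable_lambert_series hq (c := -1) (by simp) norm_one.le
  have key : ∑' n : ℕ+, (intSqSum (n * z + 1 / 2) - intSqSum (n * z)) =
      8 * (π : ℂ) ^ 2 * ∑' l : ℕ+, f (2 * l - 1) := by
    simp_rw [h0, h1]
    rw [Summable.tsum_sub
      ((summable_lambert_outer hq (c := -1) (d := 1) (by simp) (by simp)).mul_left _)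
      ((summable_lambert_outer hq (c := 1) (d := 1) (by simp) (by simp)).mul_left _),
      tsum_mul_left, tsum_mul_left, tsum_lambert hq (c := -1) (d := 1) (by simp) (by simp),
      tsum_lambert hq (c := 1) (d := 1) (by simp) (by simp),
      tsum_pnat_eq_even_add_odd (f := fun k ↦ 1 ^ k * f k) hs0,
      tsum_pnat_eq_even_add_odd (f := fun k ↦ (-1) ^ k * f k) hs1]
    have hodd (l : ℕ+) : Odd (2 * (l : ℕ) - 1) := ⟨l - 1, by have := l.pos; lia⟩
    simp only [one_pow, one_mul, (hodd _).neg_pow, (even_two_mul _).neg_pow, neg_mul, tsum_neg]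
    ring
  rw [wpFn_eq hz, intSqSum_half]
  simp_rw [h2]
  rw [key]
  have : ∑' l : ℕ+, f (2 * l - 1) = ∑' l : ℕ+, ((2 * (l : ℕ) : ℕ) - 1 : ℂ) *
      p ^ (4 * (l : ℕ) - 2) / (1 - p ^ (4 * (l : ℕ) - 2)) := by
    refine tsum_congr fun l ↦ ?_
    have hl := l.pos
    simp only [hf, one_mul]
    rw [← pow_mul, show 2 * (2 * (l : ℕ) - 1) = 4 * l - 2 by lia, Nat.cast_sub (by lia),
      Nat.cast_one]
  rw [this]
  ring

lemma wpFn_half_period {z : ℂ} (hz : 0 < z.im) :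
    wpFn z (z / 2) = 4 * (π : ℂ) ^ 2 * (-(1 / 12) - 2 * ∑' l : ℕ+, ((2 * (l : ℕ) : ℕ) - 1 : ℂ) *
      cexp (π * I * z) ^ (2 * (l : ℕ) - 1) / (1 - cexp (π * I * z) ^ (2 * (l : ℕ) - 1))) := by
  set p := cexp (π * I * z) with hp
  have hp1 : ‖p‖ < 1 := norm_exp_pi_mul_I_lt_one hz
  set h : ℕ → ℂ := fun m ↦ ∑' k : ℕ+, (k : ℂ) * 1 ^ (k : ℕ) * (p ^ m) ^ (k : ℕ) with hh
  have hg (m : ℕ) (hm : 0 < m) : intSqSum (m * z / 2) = -4 * (π : ℂ) ^ 2 * h m := by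
    have hm' : 0 < (m * z / 2).im := by
      have := mul_pos (Nat.cast_pos.mpr hm : (0 : ℝ) < m) hz
      simpa
    have : cexp (2 * π * I * (m * z / 2)) = p ^ m := by
      rw [hp, ← exp_nat_mul]
      ring_nf
    simp only [intSqSum_eq_tsum_exp hm', this, hh, one_pow, mul_one]
  have hsum : Summable fun m : ℕ+ ↦ h m := by
    simpa [hh] using summable_lambert_outer (c := 1) (d := 1) hp1 norm_one.le norm_one.le
  have halt : Summable fun m : ℕ+ ↦ (-1) ^ (m : ℕ) * h m :=
    summable_lambert_outer (d := -1) hp1 norm_one.le (by simp)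
  set f : ℕ → ℂ := fun k ↦ (k : ℂ) * p ^ k / (1 - p ^ k) with hf
  have hfs : Summable fun k : ℕ+ ↦ f k := by
    simpa [hf] using summable_lambert_series (c := 1) (d := 1) hp1 norm_one.le norm_one.le
  have hodd (l : ℕ+) : Odd (2 * (l : ℕ) - 1) := ⟨l - 1, by have := l.pos; lia⟩
  have halt' : ∑' m : ℕ+, h (2 * m) - ∑' m : ℕ+, h (2 * m - 1) = -∑' l : ℕ+, f (2 * l - 1) := by
    have e1 := tsum_pnat_eq_even_add_odd (f := fun m ↦ (-1) ^ m * h m) halt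
    simp only [(hodd _).neg_pow, (even_two_mul _).neg_pow, neg_mul, tsum_neg, one_pow, one_mul]
      at e1
    rw [sub_eq_add_neg, ← e1, tsum_lambert (d := -1) hp1 (by simp) (by simp),
      ← sub_eq_of_eq_add' (tsum_pnat_eq_even_add_odd hfs), ← hfs.tsum_sub (summable_pnat_even hfs),
      ← tsum_neg]
    refine tsum_congr fun k ↦ ?_
    have hk : ‖p ^ (k : ℕ)‖ < 1 := by
      rw [norm_pow]
      exact pow_lt_one₀ (norm_nonneg _) hp1 k.ne_zero
    have hk1 : 1 - p ^ (k : ℕ) ≠ 0 := sub_ne_zero.mpr fun h ↦ by simp [← h] at hk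
    have hk2 : 1 + p ^ (k : ℕ) ≠ 0 := fun h ↦ by
      rw [eq_neg_of_add_eq_zero_right h] at hk
      simp at hk
    have hk3 : 1 - p ^ (2 * (k : ℕ)) = (1 - p ^ (k : ℕ)) * (1 + p ^ (k : ℕ)) := by ring
    simp only [hf, hk3, one_pow, one_mul, Nat.cast_mul, Nat.cast_ofNat, neg_mul, sub_neg_eq_add]
    field_simp
    ring
  have e1 : ∑' n : ℕ+, (intSqSum (n * z - z / 2) - intSqSum (n * z)) =
      -4 * (π : ℂ) ^ 2 * (∑' m : ℕ+, h (2 * m - 1) - ∑' m : ℕ+, h (2 * m)) := by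
    rw [← (summable_pnat_odd hsum).tsum_sub (summable_pnat_even hsum), ← tsum_mul_left]
    refine tsum_congr fun n ↦ ?_
    have hn := n.pos
    rw [mul_sub, ← hg _ (by lia), ← hg _ (by lia), Nat.cast_sub (by lia)]
    push_cast
    ring_nf
  have e2 : ∑' n : ℕ+, (intSqSum (n * z + z / 2) - intSqSum (n * z)) =
      -4 * (π : ℂ) ^ 2 * (∑' m : ℕ+, h (2 * m + 1) - ∑' m : ℕ+, h (2 * m)) := by
    rw [← (summable_pnat_odd_shift hsum).tsum_sub (summable_pnat_even hsum), ← tsum_mul_left]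
    refine tsum_congr fun n ↦ ?_
    have hn := n.pos
    rw [mul_sub, ← hg _ (by lia), ← hg _ (by lia)]
    push_cast
    ring_nf
  have e3 : intSqSum (z / 2) = -4 * (π : ℂ) ^ 2 * h 1 := by
    simpa using hg 1 one_pos
  have e4 : ∑' l : ℕ+, f (2 * l - 1) = ∑' l : ℕ+, ((2 * (l : ℕ) : ℕ) - 1 : ℂ) *
      p ^ (2 * (l : ℕ) - 1) / (1 - p ^ (2 * (l : ℕ) - 1)) := by
    refine tsum_congr fun l ↦ ?_
    have hl := l.pos
    simp only [hf]
    rw [Nat.cast_sub (by lia), Nat.cast_one]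
  rw [wpFn_eq hz, e1, e2, e3, ← e4]
  linear_combination 8 * (π : ℂ) ^ 2 * halt' + 4 * (π : ℂ) ^ 2 * tsum_pnat_odd_shift hsum

lemma wpFn_half_sum_periods {z : ℂ} (hz : 0 < z.im) :
    wpFn z ((1 + z) / 2) =
      4 * (π : ℂ) ^ 2 * (-(1 / 12) + 2 * ∑' l : ℕ+, ((2 * (l : ℕ) : ℕ) - 1 : ℂ) *
        cexp (π * I * z) ^ (2 * (l : ℕ) - 1) / (1 + cexp (π * I * z) ^ (2 * (l : ℕ) - 1))) := by
  have hodd (l : ℕ+) : Odd (2 * (l : ℕ) - 1) := ⟨l - 1, by have := l.pos; lia⟩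
  have hexp : cexp (π * I * (z + 1)) = -cexp (π * I * z) := by
    rw [mul_add, exp_add, mul_one, exp_pi_mul_I, mul_neg_one]
  rw [← wpFn_add_one hz, add_comm 1 z, wpFn_half_period (by simpa using hz), hexp]
  simp only [(hodd _).neg_pow, mul_neg, neg_div, tsum_neg, sub_neg_eq_add]

/-- Lambert series expressions (3.13) for the Weierstrassian invariants `e₁, e₂, e₃`,
with `p = e(z/2) = e^{πiz}`. -/
theorem statement11 (z : ℂ) (hz : 0 < z.im) :
    wpFn z (1 / 2) =
        4 * (Real.pi : ℂ) ^ 2 *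
          (1 / 6 + 4 * ∑' l : ℕ+, ((2 * (l : ℕ) : ℕ) - 1 : ℂ) *
              Complex.exp ((Real.pi : ℂ) * Complex.I * z) ^ (4 * (l : ℕ) - 2) /
              (1 - Complex.exp ((Real.pi : ℂ) * Complex.I * z) ^ (4 * (l : ℕ) - 2))) ∧
      wpFn z (z / 2) =
        4 * (Real.pi : ℂ) ^ 2 *
          (-(1 / 12) - 2 * ∑' l : ℕ+, ((2 * (l : ℕ) : ℕ) - 1 : ℂ) *
              Complex.exp ((Real.pi : ℂ) * Complex.I * z) ^ (2 * (l : ℕ) - 1) /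
              (1 - Complex.exp ((Real.pi : ℂ) * Complex.I * z) ^ (2 * (l : ℕ) - 1))) ∧
      wpFn z ((1 + z) / 2) =
        4 * (Real.pi : ℂ) ^ 2 *
          (-(1 / 12) + 2 * ∑' l : ℕ+, ((2 * (l : ℕ) : ℕ) - 1 : ℂ) *
              Complex.exp ((Real.pi : ℂ) * Complex.I * z) ^ (2 * (l : ℕ) - 1) /
              (1 + Complex.exp ((Real.pi : ℂ) * Complex.I * z) ^ (2 * (l : ℕ) - 1))) := by
  exact ⟨wpFn_half hz, wpFn_half_period hz, wpFn_half_sum_periods hz⟩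

end
end

section
/- Let z ∈ ℂ with Im z > 0, and define Weierstrass' eta invariants η₁(1,z) := ζ_W(1/2 | 1,z), η₂(1,z) := ζ_W(z/2 | 1,z), η₃(1,z) := ζ_W(−(1+z)/2 | 1,z). Then η₁(1,z) = (π²/6)·E₂(z), η₂(1,z) = (π²/6)·E₂(z)·z − πi, and η₃(1,z) = −(π²/6)·E₂(z)·(1+z) + πi. -/
noncomputable section

open Complex MeasureTheory
open scoped Real Classical

open Filter Topology EisensteinSeries
open UpperHalfPlane hiding I

lemma sum_Icc_eq_apply_neg {R : Type*} [AddCommGroup R] {f : ℤ → R}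
    (hf : ∀ n : ℤ, f (n + 1) = -f (-n)) (N : ℕ) :
    ∑ n ∈ Finset.Icc (-N : ℤ) N, f n = f (-N) := by
  induction N with
  | zero => simp
  | succ N ih =>
    push_cast
    rw [Finset.sum_Icc_succ_eq_add_endpoints, ih, hf]
    abel

lemma sum_Icc_eq_apply {R : Type*} [AddCommGroup R] {f : ℤ → R}
    (hf : ∀ n : ℤ, f (-(n + 1)) = -f n) (N : ℕ) :
    ∑ n ∈ Finset.Icc (-N : ℤ) N, f n = f N := by
  induction N with
  | zero => simp
  | succ N ih =>
    push_cast
    rw [Finset.sum_Icc_succ_eq_add_endpoints, ih, hf]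
    abel

lemma sum_Icc_eq_zero_of_odd {R : Type*} [AddCommGroup R] [IsAddTorsionFree R] {f : ℤ → R}
    (hf : ∀ n : ℤ, f (-n) = -f n) (N : ℕ) :
    ∑ n ∈ Finset.Icc (-N : ℤ) N, f n = 0 := by
  induction N with
  | zero => simpa using self_eq_neg.mp (hf 0)
  | succ N ih =>
    push_cast
    rw [Finset.sum_Icc_succ_eq_add_endpoints, ih, hf]
    abel

lemma pi_mul_cot_pi_mul_neg (x : ℂ) :
    (π : ℂ) * Complex.cot (π * -x) = -(π * Complex.cot (π * x)) := by
  simp [Complex.cot, div_neg]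

lemma pi_mul_cot_pi_mul_sub_one (x : ℂ) :
    (π : ℂ) * Complex.cot (π * (x - 1)) = π * Complex.cot (π * x) := by
  simp [Complex.cot, mul_sub, Complex.cos_sub_pi, Complex.sin_sub_pi]

lemma summable_one_div_sub_intCast_add_one_div (x : ℂ) :
    Summable fun m : ℤ ↦ 1 / (x - m) + 1 / (m : ℂ) := by
  have h := (summable_linear_sub_mul_linear_add x 1 0).mul_left x
  refine h.congr_cofinite ?_
  have h0 : ∀ᶠ m : ℤ in cofinite, (m : ℂ) ≠ 0 := by
    have := (Set.finite_singleton (0 : ℤ)).compl_mem_cofinite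
    filter_upwards [this] with m hm
    simpa using hm
  have h1 : ∀ᶠ m : ℤ in cofinite, x - m ≠ 0 := by
    filter_upwards [(Set.finite_singleton ⌊x.re⌋).compl_mem_cofinite] with m hm h
    simp [sub_eq_zero.mp h] at hm
  filter_upwards [h0, h1] with m hm hx
  simp only [Int.cast_one, one_mul, Int.cast_zero, zero_mul, zero_add]
  field_simp
  ring

lemma hasSum_one_div_sub_intCast_add_one_div {x : ℂ} (hx : x ∈ integerComplement ∨ x = 0) :
    HasSum (fun m : ℤ ↦ 1 / (x - m) + 1 / (m : ℂ)) (π * Complex.cot (π * x)) := by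
  rcases hx with hx | rfl
  · have hs := summable_one_div_sub_intCast_add_one_div x
    convert! hs.hasSum using 1
    have hs' := summable_int_iff_summable_nat_and_neg.mp hs
    rw [tsum_int_eq_zero_add_tsum_pnat hs, cot_series_rep hx, add_assoc,
      ← Summable.tsum_add (summable_pnat_iff_summable_nat.mpr hs'.1)
        (summable_pnat_iff_summable_nat.mpr hs'.2)]
    congr 1
    · simp
    · refine tsum_congr fun n ↦ ?_
      push_cast
      rw [sub_neg_eq_add, one_div_neg_eq_neg_one_div]
      ring
  · convert! hasSum_zero using 2 with m
    · simp
    · simp [Complex.cot]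

lemma ne_zero_of_notMem_lattice (z : ℍ) {p : ℤ × ℤ} (hp : p ≠ (0, 0)) :
    (p.1 : ℂ) + p.2 * z ≠ 0 := by
  have := linear_ne_zero z (cd := ![(p.2 : ℝ), (p.1 : ℝ)]) (by
    intro h
    apply hp
    have h0 := congrFun h 0
    have h1 := congrFun h 1
    ext <;> simp_all)
  simpa [add_comm] using this

lemma summable_wzetaFn_summand (z : ℍ) (w : ℂ) :
    Summable fun p : ℤ × ℤ ↦ 1 / (w - (p.1 : ℂ) - (p.2 : ℂ) * z) + 1 / ((p.1 : ℂ) + (p.2 : ℂ) * z) +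
      w / ((p.1 : ℂ) + (p.2 : ℂ) * z) ^ 2 := by
  have h3 : Summable fun p : ℤ × ℤ ↦ (((p.1 : ℂ) + (p.2 : ℂ) * z) ^ 3)⁻¹ := by
    refine ((Equiv.prodComm ℤ ℤ).summable_iff.mpr
      (summable_prod_eisSummand (le_refl 3) z)).congr fun p ↦ ?_
    simp [eisSummand, add_comm, zpow_neg]
  refine summable_of_isBigO h3.norm ?_
  refine Asymptotics.IsBigO.of_bound (2 * ‖w‖ ^ 2) ?_
  have h0 : ∀ᶠ p : ℤ × ℤ in cofinite, p ≠ (0, 0) :=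
    (Set.finite_singleton ((0, 0) : ℤ × ℤ)).compl_mem_cofinite
  have hε : 0 < ((2 * ‖w‖ + 1) ^ 3)⁻¹ := by positivity
  have h1 := (h3.norm.tendsto_cofinite_zero).eventually (gt_mem_nhds hε)
  filter_upwards [h0, h1] with p hp hp1
  have hne := ne_zero_of_notMem_lattice z hp
  rw [sub_sub]
  set ω : ℂ := (p.1 : ℂ) + p.2 * z with hω
  have hpos : 0 < ‖ω‖ := norm_pos_iff.mpr hne
  rw [norm_inv, norm_pow, inv_lt_inv₀ (by positivity) (by positivity)] at hp1
  have hlt : 2 * ‖w‖ + 1 < ‖ω‖ := lt_of_pow_lt_pow_left₀ 3 hpos.le hp1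
  have hsub : ‖ω‖ / 2 ≤ ‖w - ω‖ := by
    have := norm_sub_norm_le ω w
    rw [norm_sub_rev] at this
    linarith
  have hsne : w - ω ≠ 0 := norm_pos_iff.mp (by linarith)
  have heq : 1 / (w - ω) + 1 / ω + w / ω ^ 2 = w ^ 2 / (ω ^ 2 * (w - ω)) := by
    field_simp
    ring
  rw [heq]
  simp only [norm_div, norm_mul, norm_pow, norm_inv, norm_norm]
  rw [div_le_iff₀ (by positivity)]
  calc ‖w‖ ^ 2 = 2 * ‖w‖ ^ 2 * (‖ω‖ ^ 3)⁻¹ * (‖ω‖ ^ 2 * (‖ω‖ / 2)) := by field_simp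
    _ ≤ _ := by gcongr

lemma hasSum_wzetaFn (z : ℍ) (w : ℂ) :
    HasSum (fun p : ℤ × ℤ ↦ 1 / (w - (p.1 : ℂ) - (p.2 : ℂ) * z) +
      1 / ((p.1 : ℂ) + (p.2 : ℂ) * z) + w / ((p.1 : ℂ) + (p.2 : ℂ) * z) ^ 2) (wzetaFn z w) := by
  have hs := summable_wzetaFn_summand z w
  convert! hs.hasSum using 1
  rw [hs.tsum_eq_add_tsum_ite (0, 0), wzetaFn]
  congr 1
  · simp
  · refine (tsum_subtype {p : ℤ × ℤ | p ≠ (0, 0)} fun p : ℤ × ℤ ↦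
      1 / (w - (p.1 : ℂ) - (p.2 : ℂ) * z) +
      1 / ((p.1 : ℂ) + (p.2 : ℂ) * z) + w / ((p.1 : ℂ) + (p.2 : ℂ) * z) ^ 2).trans ?_
    refine tsum_congr fun p ↦ ?_
    by_cases hp : p = (0, 0) <;> simp [hp, Set.indicator]

lemma hasSum_wzetaFn_row (z : ℍ) {w : ℂ} {n : ℤ} (hw : w - n * z ∈ integerComplement) :
    HasSum (fun m : ℤ ↦ 1 / (w - (m : ℂ) - (n : ℂ) * z) +
      1 / ((m : ℂ) + (n : ℂ) * z) + w / ((m : ℂ) + (n : ℂ) * z) ^ 2)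
      (π * Complex.cot (π * (w - n * z)) + π * Complex.cot (π * (n * z)) +
        w * e2Summand n z) := by
  have hn : (n : ℂ) * z ∈ integerComplement ∨ (n : ℂ) * z = 0 := by
    rcases eq_or_ne n 0 with rfl | hn
    · simp
    · left
      rintro ⟨k, hk⟩
      have := congrArg Complex.im hk
      simp [hn, z.im_ne_zero] at this
  have h1 := hasSum_one_div_sub_intCast_add_one_div (.inl hw)
  have h2 := (Equiv.neg ℤ).hasSum_iff.mpr (hasSum_one_div_sub_intCast_add_one_div hn)
  have h3 := ((e2Summand_summable n z).hasSum).mul_left w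
  convert! (h1.add h2).add h3 using 2 with m
  simp only [Function.comp_apply, Equiv.neg_apply, eisSummand, Matrix.cons_val_zero,
    Matrix.cons_val_one, Int.cast_neg, sub_neg_eq_add, zpow_neg,
    div_eq_mul_inv]
  rw [sub_right_comm, add_comm (m : ℂ)]
  norm_cast
  push_cast
  rw [inv_neg]
  ring

lemma tendsto_sum_cot_wzetaFn (z : ℍ) {w : ℂ} (hw : ∀ n : ℤ, w - n * z ∈ integerComplement) :
    Tendsto (fun N : ℕ ↦ ∑ n ∈ Finset.Icc (-N : ℤ) N, π * Complex.cot (π * (w - n * z))) atTop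
      (𝓝 (wzetaFn z w - w * G2 z)) := by
  have h := ((Equiv.prodComm ℤ ℤ).hasSum_iff.mpr (hasSum_wzetaFn z w)).prod_fiberwise
    fun n ↦ hasSum_wzetaFn_row z (hw n)
  have h1 := h.comp Finset.tendsto_Icc_neg
  have h2 := SummationFilter.hasSum_symmetricIcc_iff.mp
    ((summable_e2Summand_symmetricIcc z).hasSum.mul_left w)
  refine (h1.sub h2).congr fun N ↦ ?_
  have hodd : ∑ n ∈ Finset.Icc (-N : ℤ) N, π * Complex.cot (π * (n * z)) = 0 := by
    refine sum_Icc_eq_zero_of_odd (fun n ↦ ?_) N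
    rw [← pi_mul_cot_pi_mul_neg]
    push_cast
    ring_nf
  simp only [Function.comp_apply, Finset.sum_add_distrib, hodd]
  ring

lemma tendsto_pi_mul_cot_add_natCast_mul (z : ℍ) (u : ℂ) :
    Tendsto (fun N : ℕ ↦ π * Complex.cot (π * (u + N * z))) atTop (𝓝 (-(π * I))) := by
  have hq : Tendsto (fun N : ℕ ↦ cexp (2 * π * I * (u + N * z))) atTop (𝓝 0) := by
    have := (tendsto_pow_atTop_nhds_zero_of_norm_lt_one
      (norm_exp_two_pi_I_lt_one z)).const_mul (cexp (2 * π * I * u))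
    rw [mul_zero] at this
    refine this.congr fun N ↦ ?_
    rw [← Complex.exp_nat_mul, ← Complex.exp_add]
    ring_nf
  simp_rw [cot_pi_eq_exp_ratio]
  have := ((hq.add_const 1).div ((hq.const_sub 1).const_mul I) (by simp)).const_mul (π : ℂ)
  simpa using this

lemma E2cl_eq_E2_s14 (z : ℍ) : E2cl z = E2 z := by
  rw [E2_eq_tsum_cexp, ← tsum_pow_div_one_sub_eq_tsum_sigma (norm_exp_two_pi_I_lt_one z)]
  simp [E2cl, ee]

lemma G2_eq_mul_E2cl (z : ℍ) : G2 z = π ^ 2 / 3 * E2cl z := by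
  rw [E2cl_eq_E2_s14, E2]
  simp [riemannZeta_two]
  field

/-- Evaluation of Weierstrass' eta invariants `η₁, η₂, η₃` in terms of `E₂`. -/
theorem statement14 (z : ℂ) (hz : 0 < z.im) :
    wzetaFn z (1 / 2) = ((Real.pi : ℂ) ^ 2 / 6) * E2cl z ∧
      wzetaFn z (z / 2) =
        ((Real.pi : ℂ) ^ 2 / 6) * E2cl z * z - (Real.pi : ℂ) * Complex.I ∧
      wzetaFn z (-((1 + z) / 2)) =
        -((Real.pi : ℂ) ^ 2 / 6) * E2cl z * (1 + z) + (Real.pi : ℂ) * Complex.I := by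
  lift z to ℍ using hz
  have hG := G2_eq_mul_E2cl z
  refine ⟨?_, ?_, ?_⟩
  · have hw (n : ℤ) : (1 / 2 : ℂ) - n * z ∈ integerComplement := by
      rintro ⟨k, hk⟩
      have him := congrArg Complex.im hk
      have hn : n = 0 := by simpa [z.im_ne_zero] using him
      subst hn
      have hk2 : (k : ℂ) * 2 = 1 := by rw [hk]; norm_num
      norm_cast at hk2
      omega
    have h := tendsto_sum_cot_wzetaFn z hw
    have h0 (N : ℕ) : ∑ n ∈ Finset.Icc (-N : ℤ) N,
        π * Complex.cot (π * ((1 / 2 : ℂ) - n * z)) = 0 := by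
      refine sum_Icc_eq_zero_of_odd (fun n ↦ ?_) N
      rw [← pi_mul_cot_pi_mul_neg, ← pi_mul_cot_pi_mul_sub_one]
      congr 3
      push_cast
      ring
    simp only [h0] at h
    have := tendsto_nhds_unique tendsto_const_nhds h
    rw [hG] at this
    linear_combination -this
  · have hw (n : ℤ) : (z / 2 : ℂ) - n * z ∈ integerComplement := by
      rintro ⟨k, hk⟩
      have him := congrArg Complex.im hk
      have hn : z.im * (1 - 2 * n) = 0 := by
        simp at him
        linarith
      have hn : (1 - 2 * n : ℝ) = 0 := by simpa [z.im_ne_zero] using hn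
      norm_cast at hn
      omega
    have h := tendsto_sum_cot_wzetaFn z hw
    have h0 (N : ℕ) : ∑ n ∈ Finset.Icc (-N : ℤ) N,
        π * Complex.cot (π * ((z / 2 : ℂ) - n * z)) = π * Complex.cot (π * (z / 2 + N * z)) := by
      rw [sum_Icc_eq_apply_neg (fun n ↦ ?_) N]
      · push_cast
        ring_nf
      · rw [← pi_mul_cot_pi_mul_neg]
        congr 3
        push_cast
        ring
    simp only [h0] at h
    have := tendsto_nhds_unique (tendsto_pi_mul_cot_add_natCast_mul z _) h
    rw [hG] at this
    linear_combination -this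
  · have hw (n : ℤ) : -((1 + z) / 2 : ℂ) - n * z ∈ integerComplement := by
      rintro ⟨k, hk⟩
      have him := congrArg Complex.im hk
      have hn : z.im * (1 + 2 * n) = 0 := by
        simp at him
        linarith
      have hn : (1 + 2 * n : ℝ) = 0 := by simpa [z.im_ne_zero] using hn
      norm_cast at hn
      omega
    have h := tendsto_sum_cot_wzetaFn z hw
    have h0 (N : ℕ) : ∑ n ∈ Finset.Icc (-N : ℤ) N,
        π * Complex.cot (π * (-((1 + z) / 2 : ℂ) - n * z)) =
          -(π * Complex.cot (π * ((1 + z) / 2 + N * z))) := by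
      rw [← pi_mul_cot_pi_mul_neg, sum_Icc_eq_apply (fun n ↦ ?_) N]
      · push_cast
        ring_nf
      · rw [← pi_mul_cot_pi_mul_neg, ← pi_mul_cot_pi_mul_sub_one (-_)]
        congr 3
        push_cast
        ring
    simp only [h0] at h
    have := tendsto_nhds_unique (tendsto_pi_mul_cot_add_natCast_mul z _).neg h
    rw [hG] at this
    linear_combination -this

end
end
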